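/- Let n be a positive integer and s an integer with 0 ≤ s ≤ n−1. Then, as an identity of Laurent polynomials in q: ∑_{k=s}^{n-1} (-1)^{n-k-1} ((1-q^{2k+1})/(1-q^n)) [k+s choose 2s]_q [2s choose s]_q q^{k(k-1)/2 - sk} = [n-1 choose s]_q [n+s choose s]_q q^{n(n-1)/2 - sn}. -/

import Mathlib

open Finset

/-- The q-Pochhammer symbol `(a;q)_n = ∏_{j=0}^{n-1} (1 - a q^j)`. -/
noncomputable def qPoch {F : Type*} [Field F] (q a : F) (n : ℕ) : F :=
  ∏ j ∈ Finset.range n, (1 - a * q ^ j)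

/-- The q-binomial coefficient `[n choose k]_q`, which is
`(q;q)_n / ((q;q)_k (q;q)_{n-k})` for `0 ≤ k ≤ n` and `0` otherwise. -/
noncomputable def qBin {F : Type*} [Field F] (q : F) (n k : ℕ) : F :=
  if k ≤ n then qPoch q q n / (qPoch q q k * qPoch q q (n - k)) else 0

/-- The q-Delannoy number `D_q(m,n) = ∑_{k=0}^n q^{k(k-1)/2} [n,k]_q [n+m-k,n]_q`. -/
noncomputable def Dq {F : Type*} [Field F] (q : F) (m n : ℕ) : F :=
  ∑ k ∈ Finset.range (n + 1), q ^ (k * (k - 1) / 2) * qBin q n k * qBin q (n + m - k) n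

/-- The q-Delannoy number of the second kind
`D*_q(m,n) = ∑_{k=0}^n q^{k(k+1)/2} [n,k]_q [n+m-k,n]_q`. -/
noncomputable def Dstar {F : Type*} [Field F] (q : F) (m n : ℕ) : F :=
  ∑ k ∈ Finset.range (n + 1), q ^ (k * (k + 1) / 2) * qBin q n k * qBin q (n + m - k) n

/-- The field of rational functions `ℚ(q)`. -/
abbrev Fq : Type := FractionRing (Polynomial ℚ)

noncomputable def q : Fq := algebraMap (Polynomial ℚ) Fq Polynomial.X

lemma q_ne : (q : Fq) ≠ 0 := by
  unfold q
  simp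

lemma one_sub_q_pow_ne (n : ℕ) (hn : 0 < n) : (1 - q ^ n : Fq) ≠ 0 := by
  intro h
  have h1 : algebraMap (Polynomial ℚ) Fq (1 - Polynomial.X ^ n) = 0 := by
    rw [map_sub, map_one, map_pow]; exact h
  have h2 : (1 - Polynomial.X ^ n : Polynomial ℚ) = 0 :=
    (IsFractionRing.injective (Polynomial ℚ) Fq) (by rw [h1, map_zero])
  have h3 := congrArg (Polynomial.eval 0) h2
  simp [hn.ne'] at h3

lemma qPoch_succ (n : ℕ) : qPoch q q (n + 1) = qPoch q q n * (1 - q ^ (n + 1)) := by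
  unfold qPoch
  rw [Finset.prod_range_succ, pow_succ']

lemma qPoch_ne (n : ℕ) : qPoch q q n ≠ 0 := by
  induction n with
  | zero => simp [qPoch]
  | succ n ih =>
    rw [qPoch_succ]
    exact mul_ne_zero ih (one_sub_q_pow_ne _ (Nat.succ_pos _))

lemma qBin_mul (s m : ℕ) : qBin q (s + m + s) (2 * s) * qBin q (2 * s) s =
    qPoch q q (2 * s + m) / (qPoch q q s ^ 2 * qPoch q q m) := by
  unfold qBin
  rw [if_pos (by omega), if_pos (by omega), show s + m + s - 2 * s = m by omega,
    show 2 * s - s = s by omega, show s + m + s = 2 * s + m by omega]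
  have := qPoch_ne (2 * s)
  have := qPoch_ne s
  have := qPoch_ne m
  field_simp

lemma sum_closed (s m : ℕ) :
    ∑ j ∈ Finset.range (m + 1), (-1 : Fq) ^ j * ((1 - q ^ (2 * (s + j) + 1)) *
      (qPoch q q (2 * s + j) / (qPoch q q s ^ 2 * qPoch q q j)) *
        q ^ ((s + j) * (s + j - 1) / 2) * (q ^ (s * (s + j)))⁻¹) =
    (-1) ^ m * (qPoch q q (2 * s + m + 1) / (qPoch q q s ^ 2 * qPoch q q m) *
      q ^ ((s + m + 1) * (s + m + 1 - 1) / 2) * (q ^ (s * (s + m + 1)))⁻¹) := by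
  have hq := q_ne
  have hs := qPoch_ne s
  induction m with
  | zero =>
    rw [Finset.sum_range_one, Nat.triangle_succ, qPoch_succ]
    simp only [Nat.add_zero, mul_add, mul_one, pow_add, pow_zero, one_mul]
    field_simp
  | succ m ih =>
    have hm := qPoch_ne m
    have h1 := one_sub_q_pow_ne (m + 1) (Nat.succ_pos _)
    rw [Finset.sum_range_succ, ih, Nat.triangle_succ (s + (m + 1)), qPoch_succ (2 * s + (m + 1)),
      qPoch_succ m]
    rw [show s + m + 1 = s + (m + 1) by omega, show 2 * s + m + 1 = 2 * s + (m + 1) by omega]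
    generalize (s + (m + 1)) * (s + (m + 1) - 1) / 2 = e
    generalize qPoch q q (2 * s + (m + 1)) = A
    field_simp
    ring

theorem alternating_qbinom_sum (n s : ℕ) (hn : 0 < n) (hs : s ≤ n - 1) :
    ∑ k ∈ Finset.Icc s (n - 1),
        (-1 : Fq) ^ (n - k - 1) * ((1 - q ^ (2 * k + 1)) / (1 - q ^ n)) *
          qBin q (k + s) (2 * s) * qBin q (2 * s) s * q ^ (k * (k - 1) / 2) * (q ^ (s * k))⁻¹ =
    qBin q (n - 1) s * qBin q (n + s) s * q ^ (n * (n - 1) / 2) * (q ^ (s * n))⁻¹ := by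
  obtain ⟨m, rfl⟩ : ∃ m, n = s + m + 1 := ⟨n - 1 - s, by omega⟩
  have hI : Finset.Icc s (s + m + 1 - 1) = Finset.Ico s (s + m + 1) := by
    ext k; simp only [Finset.mem_Icc, Finset.mem_Ico]; omega
  have hN := one_sub_q_pow_ne (s + m + 1) (Nat.succ_pos _)
  rw [hI, Finset.sum_Ico_eq_sum_range, show s + m + 1 - s = m + 1 by omega]
  have key := sum_closed s m
  have hsq : ((-1 : Fq) ^ m) * (-1) ^ m = 1 := by
    rw [← mul_pow]; simp
  have step : ∀ j ∈ Finset.range (m + 1),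
      (-1 : Fq) ^ (s + m + 1 - (s + j) - 1) * ((1 - q ^ (2 * (s + j) + 1)) / (1 - q ^ (s + m + 1))) *
          qBin q (s + j + s) (2 * s) * qBin q (2 * s) s * q ^ ((s + j) * (s + j - 1) / 2) *
          (q ^ (s * (s + j)))⁻¹ =
      ((-1) ^ m / (1 - q ^ (s + m + 1))) * ((-1 : Fq) ^ j * ((1 - q ^ (2 * (s + j) + 1)) *
      (qPoch q q (2 * s + j) / (qPoch q q s ^ 2 * qPoch q q j)) *
        q ^ ((s + j) * (s + j - 1) / 2) * (q ^ (s * (s + j)))⁻¹)) := by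
    intro j hj
    have hj' := Finset.mem_range.mp hj
    have hsg : (-1 : Fq) ^ (s + m + 1 - (s + j) - 1) = (-1) ^ m * (-1) ^ j := by
      obtain ⟨i, rfl⟩ : ∃ i, m = j + i := ⟨m - j, by omega⟩
      rw [show s + (j + i) + 1 - (s + j) - 1 = i by omega, pow_add, mul_right_comm, ← mul_pow]
      simp
    rw [← qBin_mul, hsg]
    ring
  rw [Finset.sum_congr rfl step, ← Finset.mul_sum, key]
  have hb : qBin q (s + m + 1 - 1) s * qBin q (s + m + 1 + s) s =
      qPoch q q (2 * s + m + 1) / (qPoch q q s ^ 2 * qPoch q q m) / (1 - q ^ (s + m + 1)) := by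
    unfold qBin
    rw [if_pos (by omega), if_pos (by omega), show s + m + 1 - 1 = s + m by omega,
      show s + m - s = m by omega, show s + m + 1 + s - s = s + m + 1 by omega,
      show s + m + 1 + s = 2 * s + m + 1 by omega, qPoch_succ (s + m)]
    have := qPoch_ne (s + m)
    have := qPoch_ne s
    have := qPoch_ne m
    field_simp
  rw [hb, div_mul_eq_mul_div, ← mul_assoc ((-1 : Fq) ^ m), hsq]
  ring
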